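/- Assume setting (†). Let (T, M) be a local ring containing the rationals, let Q₁, Q₂ ∈ Spec(T) with Q₁ ⊄ Q₂ and Q₂ ⊄ Q₁, let T̄ = T/(Q₁ ∩ Q₂) with maximal ideal M̄, Q̄ᵢ = Qᵢ/(Q₁ ∩ Q₂), Q̄ᵢᵉ = Q̄ᵢ·T̄[[y₁, …, yₙ]], and let (R, R ∩ M̄) be a local subring of T̄ such that R contains the rationals, R is an integral domain, R ∩ Q̄₁ = R ∩ Q̄₂ = (0), and the completion of R is isomorphic to the completion of T̄. Set B′ = R[[y₁, …, yₙ]]/I·R[[y₁, …, yₙ]] and T′ = T̄[[y₁, …, yₙ]]/I·T̄[[y₁, …, yₙ]], regarded via the inclusion R[[y₁, …, yₙ]] ⊆ T̄[[y₁, …, yₙ]]. Then, writing Q′ᵢ = (Q̄ᵢᵉ, y₁, …, yₙ)/I·T̄[[y₁, …, yₙ]] for i = 1, 2, one has B′ ∩ Q′₁ = B′ ∩ Q′₂ = (y₁, …, yₙ)·R[[y₁, …, yₙ]] / I·R[[y₁, …, yₙ]]. -/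

import Mathlib

/-!
Setting (†): `y₁, …, yₙ` are indeterminates, `I` is a proper ideal of `ℚ[[y₁, …, yₙ]]`
with minimal primes `𝔮₁, …, 𝔮ₖ`, and for every integral domain `D` containing `ℚ` the
extensions `𝔮ᵢ·D[[y₁, …, yₙ]]` are prime and pairwise incomparable.

We model `A[[y₁, …, yₙ]]` as `MvPowerSeries (Fin n) A`.  A "local ring" is a
commutative Noetherian ring with exactly one maximal ideal.
-/

universe u

/-- The extension of an ideal `J` of `ℚ[[y₁, …, yₙ]]` to `A[[y₁, …, yₙ]]`, for a
`ℚ`-algebra `A`. -/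
noncomputable def Ideal.psExt (n : ℕ) (A : Type u) [CommRing A] [Algebra ℚ A]
    (J : Ideal (MvPowerSeries (Fin n) ℚ)) : Ideal (MvPowerSeries (Fin n) A) :=
  J.map (MvPowerSeries.map (algebraMap ℚ A))

/-- The extension of an ideal `a` of `A` to the power series ring `A[[y₁, …, yₙ]]`. -/
noncomputable def Ideal.constExt (n : ℕ) {A : Type u} [CommRing A] (a : Ideal A) :
    Ideal (MvPowerSeries (Fin n) A) :=
  a.map (MvPowerSeries.C (σ := Fin n) (R := A))

open IsLocalRing

namespace MvPowerSeries

/-- A power series all of whose monomials involve some variable from the finite set `s` lies in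
the ideal generated by the variables. -/
theorem mem_span_range_X_of_coeff_eq_zero {σ A : Type*} [CommRing A] (s : Finset σ)
    (φ : MvPowerSeries σ A) (h : ∀ m : σ →₀ ℕ, (∀ i ∈ s, m i = 0) → coeff m φ = 0) :
    φ ∈ Ideal.span (Set.range (X : σ → MvPowerSeries σ A)) := by
  classical
  induction s using Finset.induction_on generalizing φ with
  | empty =>
    have : φ = 0 := by
      ext m
      simpa using h m (by simp)
    simp [this]
  | insert a s _ ih =>
    let ψ : MvPowerSeries σ A := fun m => if m a = 0 then 0 else coeff m φ
    have hψ (m : σ →₀ ℕ) : coeff m ψ = if m a = 0 then 0 else coeff m φ := rfl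
    have hψX : ψ ∈ Ideal.span (Set.range (X : σ → MvPowerSeries σ A)) :=
      Ideal.mem_of_dvd _ (X_dvd_iff.2 fun m hm => by simp [hψ, hm])
        (Ideal.subset_span (Set.mem_range_self a))
    rw [← sub_add_cancel φ ψ]
    refine Ideal.add_mem _ (ih _ fun m hm => ?_) hψX
    rw [map_sub, hψ]
    split_ifs with hma
    · rw [sub_zero]
      exact h m (by simpa [hma] using hm)
    · exact sub_self _

theorem mem_span_range_X_iff {σ A : Type*} [Finite σ] [CommRing A] {φ : MvPowerSeries σ A} :
    φ ∈ Ideal.span (Set.range (X : σ → MvPowerSeries σ A)) ↔ constantCoeff φ = 0 := by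
  have := Fintype.ofFinite σ
  refine ⟨fun h => ?_, fun h => mem_span_range_X_of_coeff_eq_zero Finset.univ φ fun m hm => ?_⟩
  · have hle : Ideal.span (Set.range (X : σ → MvPowerSeries σ A)) ≤
        RingHom.ker (constantCoeff (σ := σ) (R := A)) := by
      rw [Ideal.span_le]
      rintro _ ⟨i, rfl⟩
      simp
    exact hle h
  · have : m = 0 := Finsupp.ext fun i => hm i (Finset.mem_univ i)
    simpa [this] using h

end MvPowerSeries

theorem Ideal.mem_constExt_sup_span_range_X_iff {n : ℕ} {A : Type u} [CommRing A] {a : Ideal A}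
    {φ : MvPowerSeries (Fin n) A} :
    φ ∈ a.constExt n ⊔ Ideal.span (Set.range (MvPowerSeries.X : Fin n → MvPowerSeries (Fin n) A)) ↔
      MvPowerSeries.constantCoeff φ ∈ a := by
  constructor
  · intro h
    have hle : a.constExt n ⊔
        Ideal.span (Set.range (MvPowerSeries.X : Fin n → MvPowerSeries (Fin n) A)) ≤
        a.comap MvPowerSeries.constantCoeff := by
      refine sup_le (Ideal.map_le_iff_le_comap.2 fun x hx => ?_) fun x hx => ?_
      · simpa using hx
      · rw [Ideal.mem_comap, MvPowerSeries.mem_span_range_X_iff.1 hx]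
        exact a.zero_mem
    exact hle h
  · intro h
    rw [← add_sub_cancel (MvPowerSeries.C (MvPowerSeries.constantCoeff φ)) φ]
    refine Ideal.add_mem _ (Ideal.mem_sup_left (Ideal.mem_map_of_mem _ h))
      (Ideal.mem_sup_right (MvPowerSeries.mem_span_range_X_iff.2 ?_))
    simp

theorem Ideal.psExt_le_span_range_X {n : ℕ} (A : Type u) [CommRing A] [Algebra ℚ A]
    {I : Ideal (MvPowerSeries (Fin n) ℚ)} (hI : I ≠ ⊤) :
    I.psExt n A ≤
      Ideal.span (Set.range (MvPowerSeries.X : Fin n → MvPowerSeries (Fin n) A)) := by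
  refine Ideal.map_le_iff_le_comap.2 fun x hx => ?_
  have hx0 : MvPowerSeries.constantCoeff x = 0 := by
    by_contra h
    exact hI (I.eq_top_of_isUnit_mem hx
      (MvPowerSeries.isUnit_iff_constantCoeff.2 (isUnit_iff_ne_zero.2 h)))
  rw [Ideal.mem_comap, MvPowerSeries.mem_span_range_X_iff, MvPowerSeries.constantCoeff_map, hx0,
    map_zero]

/-- If an ideal `a` of `A` meets a subring `R` in zero, then the ideal `(a, y₁, …, yₙ)` of
`A[[y₁, …, yₙ]]/I·A[[y₁, …, yₙ]]` contracts to `(y₁, …, yₙ)` in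
`R[[y₁, …, yₙ]]/I·R[[y₁, …, yₙ]]`. -/
theorem Ideal.comap_map_constExt_sup_span_range_X {n : ℕ} {A : Type u} [CommRing A] [Algebra ℚ A]
    {I : Ideal (MvPowerSeries (Fin n) ℚ)} (hI : I ≠ ⊤) (R : Subring A) [Algebra ℚ ↥R]
    {a : Ideal A} (ha : a.comap R.subtype = ⊥)
    (f : (MvPowerSeries (Fin n) ↥R ⧸ I.psExt n ↥R) →+* (MvPowerSeries (Fin n) A ⧸ I.psExt n A))
    (hf : ∀ x : MvPowerSeries (Fin n) ↥R,
      f (Ideal.Quotient.mk (I.psExt n ↥R) x) =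
        Ideal.Quotient.mk (I.psExt n A) (MvPowerSeries.map R.subtype x)) :
    Ideal.comap f ((a.constExt n ⊔ Ideal.span (Set.range
        (MvPowerSeries.X : Fin n → MvPowerSeries (Fin n) A))).map
          (Ideal.Quotient.mk (I.psExt n A))) =
      (Ideal.span (Set.range (MvPowerSeries.X : Fin n → MvPowerSeries (Fin n) ↥R))).map
        (Ideal.Quotient.mk (I.psExt n ↥R)) := by
  ext b
  obtain ⟨b, rfl⟩ := Ideal.Quotient.mk_surjective b
  rw [Ideal.mem_comap, hf,
    Ideal.mem_quotient_iff_mem ((Ideal.psExt_le_span_range_X A hI).trans le_sup_right),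
    Ideal.mem_quotient_iff_mem (Ideal.psExt_le_span_range_X ↥R hI),
    Ideal.mem_constExt_sup_span_range_X_iff, MvPowerSeries.mem_span_range_X_iff,
    MvPowerSeries.constantCoeff_map, ← Ideal.mem_comap, ha, Ideal.mem_bot]

theorem statement14
    -- Setting (†)
    (n k : ℕ) (I : Ideal (MvPowerSeries (Fin n) ℚ)) (hI : I ≠ ⊤)
    (q : Fin k → Ideal (MvPowerSeries (Fin n) ℚ)) (hqinj : Function.Injective q)
    (hqmin : I.minimalPrimes = Set.range q)
    (hqprime : ∀ (D : Type u) [CommRing D] [IsDomain D] [Algebra ℚ D] (i : Fin k),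
      ((q i).psExt n D).IsPrime)
    (hqincomp : ∀ (D : Type u) [CommRing D] [IsDomain D] [Algebra ℚ D] (i j : Fin k),
      (q i).psExt n D ≤ (q j).psExt n D ↔ i = j)
    -- the local ring `T` and the primes `Q₁`, `Q₂`; `T̄ = T/(Q₁ ∩ Q₂)`
    (T : Type u) [CommRing T] [IsNoetherianRing T] [IsLocalRing T] [Algebra ℚ T]
    (Q₁ Q₂ : Ideal T) [Q₁.IsPrime] [Q₂.IsPrime]
    (h12 : ¬Q₁ ≤ Q₂) (h21 : ¬Q₂ ≤ Q₁)
    -- `(R, R ∩ M̄)`: a local subring of `T̄` which is a domain, contains the rationals,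
    -- satisfies `R ∩ Q̄₁ = R ∩ Q̄₂ = (0)`, and whose completion is isomorphic to the
    -- completion of `T̄`
    (R : Subring (T ⧸ (Q₁ ⊓ Q₂))) (hRloc : IsLocalRing ↥R) [IsNoetherianRing ↥R]
    [Algebra ℚ ↥R] (hRdom : IsDomain ↥R)
    (hRmax : letI := hRloc; maximalIdeal ↥R =
      ((maximalIdeal T).map (Ideal.Quotient.mk (Q₁ ⊓ Q₂))).comap R.subtype)
    (hRQ1 : (Q₁.map (Ideal.Quotient.mk (Q₁ ⊓ Q₂))).comap R.subtype = ⊥)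
    (hRQ2 : (Q₂.map (Ideal.Quotient.mk (Q₁ ⊓ Q₂))).comap R.subtype = ⊥)
    (hRcomp : Nonempty
      (AdicCompletion (((maximalIdeal T).map (Ideal.Quotient.mk (Q₁ ⊓ Q₂))).comap
          R.subtype) ↥R ≃+*
        AdicCompletion ((maximalIdeal T).map (Ideal.Quotient.mk (Q₁ ⊓ Q₂)))
          (T ⧸ (Q₁ ⊓ Q₂))))
    -- `f`: the natural inclusion `B′ = R[[y₁,…,yₙ]]/I·R[[y₁,…,yₙ]] →
    -- T′ = T̄[[y₁,…,yₙ]]/I·T̄[[y₁,…,yₙ]]`; "intersecting" an ideal of `T′` with `B′`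
    -- means taking `Ideal.comap f`
    (f : (MvPowerSeries (Fin n) ↥R ⧸ I.psExt n ↥R) →+*
      (MvPowerSeries (Fin n) (T ⧸ (Q₁ ⊓ Q₂)) ⧸ I.psExt n (T ⧸ (Q₁ ⊓ Q₂))))
    (hf : ∀ x : MvPowerSeries (Fin n) ↥R,
      f (Ideal.Quotient.mk (I.psExt n ↥R) x) =
        Ideal.Quotient.mk (I.psExt n (T ⧸ (Q₁ ⊓ Q₂)))
          (MvPowerSeries.map R.subtype x)) :
    -- with `Q′ᵢ = (Q̄ᵢᵉ, y₁, …, yₙ)/I·T̄[[y₁,…,yₙ]]`, one has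
    -- `B′ ∩ Q′₁ = B′ ∩ Q′₂ = (y₁, …, yₙ)·R[[y₁,…,yₙ]]/I·R[[y₁,…,yₙ]]`
    Ideal.comap f
        (((Q₁.map (Ideal.Quotient.mk (Q₁ ⊓ Q₂))).constExt n ⊔
            Ideal.span (Set.range
              (MvPowerSeries.X : Fin n → MvPowerSeries (Fin n) (T ⧸ (Q₁ ⊓ Q₂))))).map
          (Ideal.Quotient.mk (I.psExt n (T ⧸ (Q₁ ⊓ Q₂))))) =
      Ideal.comap f
        (((Q₂.map (Ideal.Quotient.mk (Q₁ ⊓ Q₂))).constExt n ⊔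
            Ideal.span (Set.range
              (MvPowerSeries.X : Fin n → MvPowerSeries (Fin n) (T ⧸ (Q₁ ⊓ Q₂))))).map
          (Ideal.Quotient.mk (I.psExt n (T ⧸ (Q₁ ⊓ Q₂))))) ∧
    Ideal.comap f
        (((Q₁.map (Ideal.Quotient.mk (Q₁ ⊓ Q₂))).constExt n ⊔
            Ideal.span (Set.range
              (MvPowerSeries.X : Fin n → MvPowerSeries (Fin n) (T ⧸ (Q₁ ⊓ Q₂))))).map
          (Ideal.Quotient.mk (I.psExt n (T ⧸ (Q₁ ⊓ Q₂))))) =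
      (Ideal.span (Set.range
          (MvPowerSeries.X : Fin n → MvPowerSeries (Fin n) ↥R))).map
        (Ideal.Quotient.mk (I.psExt n ↥R)) := by
  have h₁ := Ideal.comap_map_constExt_sup_span_range_X hI R hRQ1 f hf
  have h₂ := Ideal.comap_map_constExt_sup_span_range_X hI R hRQ2 f hf
  exact ⟨h₁.trans h₂.symm, h₁⟩
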